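/- Let (X,G) be a G-metric space and let T : X → X be a mapping such that there exists λ ∈ [0,1) with the property: for each x ∈ X there exists a positive integer n(x) such that G(T^{n(x)} x, T^{n(x)} y, T^{n(x)} z) ≤ λ · G(x, y, z) for all y, z ∈ X. Fix x_0 ∈ X and define inductively x_{i+1} = T^{n(x_i)} x_i. Then G(x_k, x_{k+1}, x_{k+1}) ≤ λ^k · r(x_0) for all k ≥ 0, where r(x_0) = sup_{n ≥ 1} G(x_0, T^n x_0, T^n x_0), and consequently (x_k) is a G-Cauchy sequence. -/

import Mathlib

/-- A G-metric on a set `X`: a function `G : X × X × X → [0,∞)` satisfying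
(G1) `G x x x = 0`; (G2) `G x x y > 0` for `x ≠ y`; (G3) `G x x y ≤ G x y z` for `z ≠ y`;
(G4) symmetry in all three variables; (G5) `G x y z ≤ G x a a + G a y z`. -/
def IsGMetric {X : Type*} (G : X → X → X → ℝ) : Prop :=
  (∀ x y z, 0 ≤ G x y z) ∧
  (∀ x, G x x x = 0) ∧
  (∀ x y, x ≠ y → 0 < G x x y) ∧
  (∀ x y z, z ≠ y → G x x y ≤ G x y z) ∧
  (∀ x y z, G x y z = G x z y) ∧
  (∀ x y z, G x y z = G y z x) ∧
  (∀ x y z a, G x y z ≤ G x a a + G a y z)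

/-- A sequence `s` G-converges to `x` iff `G x (s n) (s n) → 0`. -/
def GConvergesTo {X : Type*} (G : X → X → X → ℝ) (s : ℕ → X) (x : X) : Prop :=
  Filter.Tendsto (fun n => G x (s n) (s n)) Filter.atTop (nhds 0)

/-- A sequence `s` is G-Cauchy iff for every `ε > 0` there is `N` with
`G (s n) (s m) (s m) < ε` for all `m, n ≥ N`. -/
def IsGCauchy {X : Type*} (G : X → X → X → ℝ) (s : ℕ → X) : Prop :=
  ∀ ε > (0 : ℝ), ∃ N : ℕ, ∀ m ≥ N, ∀ n ≥ N, G (s n) (s m) (s m) < ε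

/-- `(X, G)` is G-complete iff every G-Cauchy sequence G-converges to some point. -/
def IsGComplete {X : Type*} (G : X → X → X → ℝ) : Prop :=
  ∀ s : ℕ → X, IsGCauchy G s → ∃ x, GConvergesTo G s x

/-- `T` is G-continuous iff it maps G-convergent sequences to G-convergent sequences. -/
def IsGContinuous {X : Type*} (G : X → X → X → ℝ) (T : X → X) : Prop :=
  ∀ (s : ℕ → X) (x : X), GConvergesTo G s x → GConvergesTo G (fun n => T (s n)) (T x)

/-- In a G-metric space, `(x, y) ↦ G x y y` satisfies the triangle inequality. -/
lemma IsGMetric.triangle {X : Type*} {G : X → X → X → ℝ} (hG : IsGMetric G) (x a y : X) :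
    G x y y ≤ G x a a + G a y y :=
  hG.2.2.2.2.2.2 x y y a

/-- `(x, y) ↦ G x y y` is symmetric up to a factor of two. -/
lemma IsGMetric.le_two_mul_swap {X : Type*} {G : X → X → X → ℝ} (hG : IsGMetric G) (x y : X) :
    G x y y ≤ 2 * G y x x := by
  obtain ⟨-, -, -, -, -, hrot, htri⟩ := hG
  have h := htri y y x x
  rw [hrot x y x] at h
  rw [hrot x y y]
  linarith

/-- If some iterate of `T` contracts distances from `x`, then the orbit of `x` is bounded. -/
lemma IsGMetric.bddAbove_orbit {X : Type*} {G : X → X → X → ℝ} (hG : IsGMetric G)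
    {T : X → X} {lam : ℝ} (hlam0 : 0 ≤ lam) (hlam1 : lam < 1) {x : X} {n : ℕ} (hn : 0 < n)
    (h : ∀ y, G (T^[n] x) (T^[n] y) (T^[n] y) ≤ lam * G x y y) :
    BddAbove (Set.range fun m => G x (T^[m] x) (T^[m] x)) := by
  obtain ⟨M, hM⟩ := ((Finset.range (n + 1)).image fun m => G x (T^[m] x) (T^[m] x)).bddAbove
  have hM' : ∀ j ≤ n, G x (T^[j] x) (T^[j] x) ≤ M := fun j hj =>
    hM (Finset.mem_coe.2 (Finset.mem_image_of_mem _ (Finset.mem_range.2 (by omega))))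
  have hM0 : 0 ≤ M := (hG.1 _ _ _).trans (hM' 0 (Nat.zero_le n))
  have hlam : 0 < 1 - lam := sub_pos.2 hlam1
  have hfix : M + lam * (M / (1 - lam)) = M / (1 - lam) := by
    field_simp
    ring
  refine ⟨M / (1 - lam), ?_⟩
  rintro _ ⟨m, rfl⟩
  induction m using Nat.strong_induction_on with
  | _ m ih =>
    dsimp only at ih ⊢
    rcases le_total m n with hmn | hmn
    · have : 0 ≤ lam * (M / (1 - lam)) := by positivity
      linarith [hM' m hmn]
    · obtain ⟨k, rfl⟩ := Nat.exists_eq_add_of_le hmn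
      have hk := mul_le_mul_of_nonneg_left (ih k (by omega)) hlam0
      have hc := h (T^[k] x)
      rw [← Function.iterate_add_apply] at hc
      linarith [hG.triangle x (T^[n] x) (T^[n + k] x), hM' n le_rfl]

/-- **Lemma.** Under the power-contraction condition (with a chosen witness function
`N : X → ℕ`), the inductively defined sequence `x_{k+1} = T^[N (x_k)] (x_k)` satisfies
`G(x_k, x_{k+1}, x_{k+1}) ≤ λ^k · r(x_0)`, where
`r(x_0) = sup_{m ≥ 1} G(x_0, T^m x_0, T^m x_0)`, and in particular it is G-Cauchy. -/
theorem gmetric_power_contraction_iterates_cauchy {X : Type*}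
    (G : X → X → X → ℝ) (hG : IsGMetric G)
    (T : X → X) (lam : ℝ) (hlam0 : 0 ≤ lam) (hlam1 : lam < 1)
    (N : X → ℕ) (hNpos : ∀ x, 0 < N x)
    (hN : ∀ x y z : X, G (T^[N x] x) (T^[N x] y) (T^[N x] z) ≤ lam * G x y z)
    (x0 : X) (seq : ℕ → X) (hseq0 : seq 0 = x0)
    (hseq : ∀ k, seq (k + 1) = T^[N (seq k)] (seq k)) :
    (∀ k : ℕ, G (seq k) (seq (k + 1)) (seq (k + 1)) ≤
      lam ^ k * sSup {r : ℝ | ∃ m : ℕ, 1 ≤ m ∧ r = G x0 (T^[m] x0) (T^[m] x0)}) ∧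
    IsGCauchy G seq := by
  set S : Set ℝ := {r : ℝ | ∃ m : ℕ, 1 ≤ m ∧ r = G x0 (T^[m] x0) (T^[m] x0)}
  have hbdd : BddAbove S :=
    (hG.bddAbove_orbit hlam0 hlam1 (hNpos x0) fun y => hN x0 y y).mono <| by
      rintro _ ⟨m, -, rfl⟩
      exact ⟨m, rfl⟩
  have hr : 0 ≤ sSup S := (hG.1 _ _ _).trans (le_csSup hbdd ⟨1, le_rfl, rfl⟩)
  have horbit : ∀ k m : ℕ,
      G (seq k) (T^[m] (seq k)) (T^[m] (seq k)) ≤ lam ^ k * sSup S := by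
    intro k
    induction k with
    | zero =>
      intro m
      rw [hseq0, pow_zero, one_mul]
      rcases Nat.eq_zero_or_pos m with rfl | hm
      · simpa [hG.2.1] using hr
      · exact le_csSup hbdd ⟨m, hm, rfl⟩
    | succ k ih =>
      intro m
      rw [hseq k, (Function.Commute.iterate_iterate_self T m (N (seq k))).eq, pow_succ', mul_assoc]
      exact (hN _ _ _).trans (mul_le_mul_of_nonneg_left (ih m) hlam0)
  have hiter : ∀ n j : ℕ, ∃ m, seq (n + j) = T^[m] (seq n) := by
    intro n j
    induction j with
    | zero => exact ⟨0, rfl⟩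
    | succ j ih =>
      obtain ⟨m, hm⟩ := ih
      refine ⟨N (seq (n + j)) + m, ?_⟩
      rw [Function.iterate_add_apply, ← hm, ← hseq, Nat.add_assoc]
  have hle : ∀ n m : ℕ, n ≤ m → G (seq n) (seq m) (seq m) ≤ lam ^ n * sSup S := by
    intro n m hnm
    obtain ⟨j, rfl⟩ := Nat.exists_eq_add_of_le hnm
    obtain ⟨p, hp⟩ := hiter n j
    rw [hp]
    exact horbit n p
  refine ⟨fun k => hle k (k + 1) k.le_succ, fun ε hε => ?_⟩
  have hlim : Filter.Tendsto (fun k : ℕ => 2 * (lam ^ k * sSup S)) Filter.atTop (nhds 0) := by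
    simpa using ((tendsto_pow_atTop_nhds_zero_of_lt_one hlam0 hlam1).mul_const (sSup S)).const_mul 2
  obtain ⟨K, hK⟩ := Filter.eventually_atTop.1 (hlim.eventually_lt_const hε)
  refine ⟨K, fun m hm n hn => ?_⟩
  rcases le_total n m with hnm | hmn
  · have : 0 ≤ lam ^ n * sSup S := by positivity
    linarith [hle n m hnm, hK n hn]
  · linarith [hle m n hmn, hK m hm, hG.le_two_mul_swap (seq n) (seq m)]
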